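/- arXiv:1902.04731 — 2 statements merged into one kernel-verified Lean document; each statement's English description precedes it below -/
import Mathlib

section
/- Let s be an even positive integer, let t ≥ s be an integer, let c > 0, and let M be a symmetric real n×n matrix. Suppose S' ⊆ {1,…,n} has cardinality t and satisfies ‖M_{S'×S'}‖_F² ≥ c² · ‖M_{S×S}‖_F² for every index set S of cardinality s. Then there exists an index set T ⊆ S' with |T| ≤ s such that ‖M_{T×T}‖_F² ≥ (c²·s²/(4t²)) · ‖M_{S×S}‖_F² for every index set S of cardinality s. (Namely, one may take T = R ∪ C, where R ⊆ S' consists of s/2 indices i maximizing ‖M_{i×S'}‖₂ and C ⊆ S' consists of s/2 indices j maximizing ‖M_{R×j}‖₂.) -/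
open Matrix Finset MeasureTheory
open scoped ENNReal NNReal

/-- Frobenius norm of a real `n × n` matrix. -/
noncomputable def frobNorm {n : ℕ} (M : Matrix (Fin n) (Fin n) ℝ) : ℝ :=
  Real.sqrt (∑ i, ∑ j, (M i j) ^ 2)

/-- Frobenius inner product `⟨A, B⟩_F = tr(Aᵀ B)`. -/
def frobInner {n : ℕ} (A B : Matrix (Fin n) (Fin n) ℝ) : ℝ :=
  ∑ i, ∑ j, A i j * B i j

/-- Euclidean (ℓ₂) norm on `ℝ^m`. -/
noncomputable def l2norm {m : ℕ} (y : Fin m → ℝ) : ℝ :=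
  Real.sqrt (∑ i, (y i) ^ 2)

/-- ℓ₁ norm on `ℝ^m`. -/
def l1norm {m : ℕ} (y : Fin m → ℝ) : ℝ := ∑ i, |y i|

/-- `restr M S T` is the matrix equal to `M` on entries `(i,j)` with `i ∈ S`, `j ∈ T`,
and zero elsewhere. -/
def restr {n : ℕ} (M : Matrix (Fin n) (Fin n) ℝ) (S T : Finset (Fin n)) :
    Matrix (Fin n) (Fin n) ℝ :=
  Matrix.of fun i j => if i ∈ S ∧ j ∈ T then M i j else 0

/-- `Σ_{(s)}^{[r]}`: symmetric matrices of rank at most `r` supported on `S × S` for some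
index set `S` of cardinality `s`. -/
def SigmaRS (n r s : ℕ) : Set (Matrix (Fin n) (Fin n) ℝ) :=
  {M | M.IsSymm ∧ M.rank ≤ r ∧ ∃ S : Finset (Fin n), S.card = s ∧ M = restr M S S}

/-- `Y` is a best rank-`r` Frobenius approximation of `A`. -/
noncomputable def IsBestRankApprox {n : ℕ} (r : ℕ) (A Y : Matrix (Fin n) (Fin n) ℝ) : Prop :=
  Y.rank ≤ r ∧
    ∀ Z : Matrix (Fin n) (Fin n) ℝ, Z.rank ≤ r → frobNorm (A - Y) ≤ frobNorm (A - Z)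

/-- Among the `k`-subsets of a finite set, some subset carries at least the average share
`k / #A` of the sum of `f`. -/
theorem exists_subset_card_mul_sum_le {α : Type*} [DecidableEq α] (A : Finset α) (f : α → ℝ)
    {k : ℕ} (hk : k ≤ A.card) :
    ∃ R ⊆ A, R.card = k ∧ (k : ℝ) * ∑ i ∈ A, f i ≤ A.card * ∑ i ∈ R, f i := by
  induction hk using Nat.decreasingInduction with
  | self => exact ⟨A, Subset.rfl, rfl, le_rfl⟩
  | of_succ k hk ih =>
    obtain ⟨R, hRA, hRcard, hR⟩ := ih
    obtain ⟨m, hmR, hm⟩ := R.exists_min_image f (Finset.card_pos.mp (by omega))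
    refine ⟨R.erase m, (R.erase_subset m).trans hRA, by rw [card_erase_of_mem hmR]; omega, ?_⟩
    have hsum : ∑ i ∈ R.erase m, f i + f m = ∑ i ∈ R, f i := sum_erase_add R f hmR
    have hmin : ((k : ℝ) + 1) * f m ≤ ∑ i ∈ R, f i := by
      simpa [hRcard] using R.card_nsmul_le_sum f (f m) hm
    have hA := mul_le_mul_of_nonneg_left hmin (Nat.cast_nonneg (α := ℝ) A.card)
    push_cast at hR
    have hk0 := mul_le_mul_of_nonneg_left hR (Nat.cast_nonneg (α := ℝ) k)
    rw [eq_sub_of_add_eq hsum]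
    refine le_of_mul_le_mul_left (a := (k : ℝ) + 1) ?_ (by positivity)
    linarith

theorem frobNorm_restr_sq {n : ℕ} (M : Matrix (Fin n) (Fin n) ℝ) (S T : Finset (Fin n)) :
    frobNorm (restr M S T) ^ 2 = ∑ i ∈ S, ∑ j ∈ T, M i j ^ 2 := by
  rw [frobNorm, Real.sq_sqrt (by positivity)]
  simp [restr, ite_and, ite_pow]

theorem sum_sum_sq_le_of_subset {n : ℕ} (M : Matrix (Fin n) (Fin n) ℝ)
    {R C T : Finset (Fin n)} (hR : R ⊆ T) (hC : C ⊆ T) :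
    ∑ i ∈ R, ∑ j ∈ C, M i j ^ 2 ≤ ∑ i ∈ T, ∑ j ∈ T, M i j ^ 2 :=
  (sum_le_sum fun _ _ => sum_le_sum_of_subset_of_nonneg hC fun _ _ _ => sq_nonneg _).trans
    (sum_le_sum_of_subset_of_nonneg hR fun _ _ _ => sum_nonneg fun _ _ => sq_nonneg _)

/-- extracting a size-`s` head set from a size-`t` head set. -/
theorem stmt8 {n s t : ℕ} (hs : 0 < s) (hse : Even s) (hts : s ≤ t) (c : ℝ) (hc : 0 < c)
    (M : Matrix (Fin n) (Fin n) ℝ) (hM : M.IsSymm)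
    (S' : Finset (Fin n)) (hS' : S'.card = t)
    (hhead : ∀ S : Finset (Fin n), S.card = s →
      frobNorm (restr M S' S') ^ 2 ≥ c ^ 2 * frobNorm (restr M S S) ^ 2) :
    ∃ T : Finset (Fin n), T ⊆ S' ∧ T.card ≤ s ∧
      ∀ S : Finset (Fin n), S.card = s →
        frobNorm (restr M T T) ^ 2 ≥
          (c ^ 2 * s ^ 2 / (4 * t ^ 2)) * frobNorm (restr M S S) ^ 2 := by
  obtain ⟨k, rfl⟩ := hse
  obtain ⟨R, hRS, hRcard, hR⟩ := exists_subset_card_mul_sum_le S' (fun i => ∑ j ∈ S', M i j ^ 2)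
    (k := k) (by omega)
  obtain ⟨C, hCS, hCcard, hC⟩ := exists_subset_card_mul_sum_le S' (fun j => ∑ i ∈ R, M i j ^ 2)
    (k := k) (by omega)
  refine ⟨R ∪ C, union_subset hRS hCS, (card_union_le R C).trans (by omega), fun S hS => ?_⟩
  have hT := sum_sum_sq_le_of_subset M (subset_union_left (s₁ := R) (s₂ := C)) subset_union_right
  have hS'S := hhead S hS
  rw [sum_comm, sum_comm (s := C)] at hC
  rw [hS'] at hR hC
  rw [frobNorm_restr_sq M S' S'] at hS'S
  rw [frobNorm_restr_sq M (R ∪ C), ge_iff_le, div_mul_eq_mul_div]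
  have ht : (0 : ℝ) < t := Nat.cast_pos.mpr (by omega)
  rw [div_le_iff₀ (by positivity)]
  have hS'S := mul_le_mul_of_nonneg_left hS'S (sq_nonneg (k : ℝ))
  have hR := mul_le_mul_of_nonneg_left hR (Nat.cast_nonneg (α := ℝ) k)
  have hC := mul_le_mul_of_nonneg_left hC ht.le
  have hT := mul_le_mul_of_nonneg_left hT (sq_nonneg (t : ℝ))
  push_cast
  linarith
end

section
/- Let M be a symmetric real n×n matrix, let 1 ≤ r and 1 ≤ s ≤ n. Suppose that for each index set S of cardinality s, Y_S is a symmetric best rank-r Frobenius approximation of M_{S×S}, and suppose S⋆ of cardinality s satisfies ‖Y_{S⋆}‖_F ≥ ‖Y_S‖_F for every index set S of cardinality s. Then Y_{S⋆} ∈ Σ_{(s)}^{[r]}, and Y_{S⋆} is a best approximation of M from Σ_{(s)}^{[r]}: ‖M − Y_{S⋆}‖_F ≤ ‖M − Z‖_F for every Z ∈ Σ_{(s)}^{[r]}. (In other words, the projection of M onto Σ_{(s)}^{[r]} has the form P^{[r]}(M_{S⋆×S⋆}) where S⋆ maximizes ‖P^{[r]}(M_{S×S})‖_F over index sets S of cardinality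 s.) -/
open Matrix Finset MeasureTheory
open scoped ENNReal NNReal

theorem frobNorm_le_frobNorm_iff {n : ℕ} (A B : Matrix (Fin n) (Fin n) ℝ) :
    frobNorm A ≤ frobNorm B ↔ frobInner A A ≤ frobInner B B := by
  unfold frobNorm frobInner
  rw [Real.sqrt_le_sqrt_iff (by positivity)]
  simp only [sq]

theorem frobInner_sub_self {n : ℕ} (A B : Matrix (Fin n) (Fin n) ℝ) :
    frobInner (A - B) (A - B) = frobInner A A - 2 * frobInner A B + frobInner B B := by
  simp only [frobInner, Finset.mul_sum, ← Finset.sum_sub_distrib, ← Finset.sum_add_distrib,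
    Matrix.sub_apply]
  refine Finset.sum_congr rfl fun i _ => Finset.sum_congr rfl fun j _ => ?_
  ring

theorem frobInner_smul_right {n : ℕ} (t : ℝ) (A B : Matrix (Fin n) (Fin n) ℝ) :
    frobInner A (t • B) = t * frobInner A B := by
  simp only [frobInner, Finset.mul_sum, Matrix.smul_apply, smul_eq_mul]
  refine Finset.sum_congr rfl fun i _ => Finset.sum_congr rfl fun j _ => ?_
  ring

theorem frobInner_comm {n : ℕ} (A B : Matrix (Fin n) (Fin n) ℝ) :
    frobInner A B = frobInner B A := by
  simp only [frobInner, mul_comm]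

theorem eq_zero_of_frobInner_self_nonpos {n : ℕ} {A : Matrix (Fin n) (Fin n) ℝ}
    (h : frobInner A A ≤ 0) : A = 0 := by
  ext i j
  have hi := Finset.single_le_sum (f := fun i => ∑ j, A i j * A i j)
    (fun i _ => Finset.sum_nonneg fun j _ => mul_self_nonneg _) (Finset.mem_univ i)
  have hj := Finset.single_le_sum (f := fun j => A i j * A i j)
    (fun j _ => mul_self_nonneg _) (Finset.mem_univ j)
  exact mul_self_eq_zero.mp (le_antisymm ((hj.trans hi).trans h) (mul_self_nonneg _))

theorem frobInner_restr_left {n : ℕ} (A B : Matrix (Fin n) (Fin n) ℝ) (S T : Finset (Fin n)) :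
    frobInner (restr A S T) B = frobInner A (restr B S T) := by
  simp [frobInner, restr]

theorem restr_restr {n : ℕ} (A : Matrix (Fin n) (Fin n) ℝ) (S T : Finset (Fin n)) :
    restr (restr A S T) S T = restr A S T := by
  ext i j
  by_cases h : i ∈ S ∧ j ∈ T <;> simp [restr, h]

theorem rank_restr_le {n : ℕ} (A : Matrix (Fin n) (Fin n) ℝ) (S T : Finset (Fin n)) :
    (restr A S T).rank ≤ A.rank := by
  have h : restr A S T = Matrix.diagonal (fun i => if i ∈ S then (1 : ℝ) else 0) * A *
      Matrix.diagonal (fun j => if j ∈ T then (1 : ℝ) else 0) := by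
    ext i j
    by_cases hi : i ∈ S <;> by_cases hj : j ∈ T <;> simp [restr, hi, hj]
  rw [h]
  exact (Matrix.rank_mul_le_left _ _).trans (Matrix.rank_mul_le_right _ _)

theorem rank_smul_le {n : ℕ} (t : ℝ) (A : Matrix (Fin n) (Fin n) ℝ) :
    (t • A).rank ≤ A.rank := by
  rw [Matrix.smul_eq_diagonal_mul]
  exact Matrix.rank_mul_le_right _ _

/-- A best rank-`r` approximation of a matrix supported on `S × T` is supported on `S × T`. -/
theorem IsBestRankApprox.eq_restr {n r : ℕ} {M Y : Matrix (Fin n) (Fin n) ℝ}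
    {S T : Finset (Fin n)} (h : IsBestRankApprox r (restr M S T) Y) : Y = restr Y S T := by
  have hle := h.2 (restr Y S T) ((rank_restr_le Y S T).trans h.1)
  rw [frobNorm_le_frobNorm_iff, frobInner_sub_self, frobInner_sub_self,
    frobInner_restr_left M Y, frobInner_restr_left M (restr Y S T), restr_restr] at hle
  refine sub_eq_zero.mp (eq_zero_of_frobInner_self_nonpos ?_)
  have hY : frobInner (restr Y S T) (restr Y S T) = frobInner Y (restr Y S T) := by
    rw [frobInner_restr_left, restr_restr]
  rw [frobInner_sub_self]
  linarith

/-- The residual of a best rank-`r` approximation is orthogonal to the approximation. -/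
theorem IsBestRankApprox.frobInner_eq {n r : ℕ} {A Y : Matrix (Fin n) (Fin n) ℝ}
    (h : IsBestRankApprox r A Y) : frobInner A Y = frobInner Y Y := by
  have hquad : ∀ u : ℝ, 0 ≤ frobInner Y Y * (u * u) +
      2 * (frobInner Y Y - frobInner A Y) * u + 0 := by
    intro u
    have hle := h.2 ((1 + u) • Y) ((rank_smul_le _ Y).trans h.1)
    rw [frobNorm_le_frobNorm_iff, frobInner_sub_self, frobInner_sub_self,
      frobInner_smul_right, frobInner_smul_right, frobInner_comm (_ • Y) Y,
      frobInner_smul_right] at hle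
    linarith
  have hd := discrim_le_zero hquad
  rw [discrim] at hd
  nlinarith [sq_nonneg (frobInner Y Y - frobInner A Y)]

/-- the form of the exact projection onto `Σ_{(s)}^{[r]}`. -/
theorem stmt17 {n r s : ℕ} (hr : 1 ≤ r) (hs1 : 1 ≤ s) (hsn : s ≤ n)
    (M : Matrix (Fin n) (Fin n) ℝ) (hM : M.IsSymm)
    (Y : Finset (Fin n) → Matrix (Fin n) (Fin n) ℝ)
    (hY : ∀ S : Finset (Fin n), S.card = s →
      (Y S).IsSymm ∧ IsBestRankApprox r (restr M S S) (Y S))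
    (Sstar : Finset (Fin n)) (hcard : Sstar.card = s)
    (hmax : ∀ S : Finset (Fin n), S.card = s → frobNorm (Y S) ≤ frobNorm (Y Sstar)) :
    Y Sstar ∈ SigmaRS n r s ∧
      ∀ Z ∈ SigmaRS n r s, frobNorm (M - Y Sstar) ≤ frobNorm (M - Z) := by
  obtain ⟨hsymm, hbest⟩ := hY Sstar hcard
  refine ⟨⟨hsymm, hbest.1, Sstar, hcard, hbest.eq_restr⟩, ?_⟩
  rintro Z ⟨-, hZr, S, hS, hZ⟩
  have hle := (hY S hS).2.2 Z hZr
  have horth := (hY S hS).2.frobInner_eq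
  have horth' := hbest.frobInner_eq
  have hm := hmax S hS
  rw [frobInner_restr_left, ← hbest.eq_restr] at horth'
  rw [frobNorm_le_frobNorm_iff] at hle hm ⊢
  rw [frobInner_sub_self, frobInner_sub_self, horth, frobInner_restr_left M Z, ← hZ] at hle
  rw [frobInner_sub_self, frobInner_sub_self]
  linarith
end
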